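/- Let R = ℤ[U₀, U₁, U₂, U₃, U₄, U₅, U₆] be the polynomial ring in seven variables over ℤ. Let L = (U₁ + U₂ − U₃ − U₄, U₃ + U₄ − U₅ − U₆), Q = (U₅ − U₀, U₆ − U₂, U₁U₂ − U₃U₄, U₃U₄ − U₅U₆), and N = Q + (U₁ − U₅) be ideals of R. Then for every natural number i there is an isomorphism of R-modules Tor_i^R(R/L, R/N) ≅ Tor_i^R(R/L, R/Q). -/

import Mathlib

open CategoryTheory MvPolynomial

/-- The polynomial ring `R = ℤ[U₀, …, U₆]` in seven variables over `ℤ`. -/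
noncomputable abbrev R0 : Type := MvPolynomial (Fin 7) ℤ

/-- The variable `Uᵢ`. -/
noncomputable def U (i : Fin 7) : R0 := X i

/-- The ideal `L = (U₁ + U₂ − U₃ − U₄, U₃ + U₄ − U₅ − U₆)`. -/
noncomputable def Lideal : Ideal R0 :=
  Ideal.span {U 1 + U 2 - U 3 - U 4, U 3 + U 4 - U 5 - U 6}

/-- The ideal `Q = (U₅ − U₀, U₆ − U₂, U₁U₂ − U₃U₄, U₃U₄ − U₅U₆)`. -/
noncomputable def Qideal : Ideal R0 :=
  Ideal.span {U 5 - U 0, U 6 - U 2, U 1 * U 2 - U 3 * U 4, U 3 * U 4 - U 5 * U 6}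

/-- The ideal `N = Q + (U₁ − U₅)`. -/
noncomputable def Nideal : Ideal R0 := Qideal + Ideal.span {U 1 - U 5}

namespace KoszulTor

section Homological

open Limits MonoidalCategory

universe u

variable {R : Type u} [CommRing R]

/-- The functor `X ↦ X ⊗ P` for a chain complex `P` of modules. -/
noncomputable def tensorComplex (P : ChainComplex (ModuleCat.{u} R) ℕ) :
    ModuleCat.{u} R ⥤ ChainComplex (ModuleCat.{u} R) ℕ where
  obj X := (((tensoringLeft (ModuleCat.{u} R)).obj X).mapHomologicalComplex _).obj P
  map f := (NatTrans.mapHomologicalComplex ((tensoringLeft (ModuleCat.{u} R)).map f) _).app P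
  map_id X := by ext : 1; simp
  map_comp f g := by ext : 1; simp

instance (P : ChainComplex (ModuleCat.{u} R) ℕ) : (tensorComplex P).Additive where
  map_add {X Y f g} := by
    ext i : 1
    exact MonoidalPreadditive.add_whiskerRight f g

instance (P : ChainComplex (ModuleCat.{u} R) ℕ) : (tensorComplex P).Linear R where
  map_smul {X Y} f r := by
    ext i : 1
    exact MonoidalLinear.smul_whiskerRight r f (P.X i)

lemma tensorComplex_shortExact (P : ChainComplex (ModuleCat.{u} R) ℕ)
    [∀ i, Projective (P.X i)] {S : ShortComplex (ModuleCat.{u} R)} (hS : S.ShortExact) :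
    (S.map (tensorComplex P)).ShortExact := by
  refine HomologicalComplex.shortExact_of_degreewise_shortExact _ fun i ↦ ?_
  have : Module.Projective R (P.X i) := 
    (IsProjective.iff_projective _).mpr (inferInstanceAs (Projective (P.X i)))
  exact hS.map_of_exact (tensorRight (P.X i))

lemma homologyMap_smul {K L : ChainComplex (ModuleCat.{u} R) ℕ} (l : R) (f : K ⟶ L) (i : ℕ) :
    HomologicalComplex.homologyMap (l • f) i = l • HomologicalComplex.homologyMap f i :=
  ShortComplex.homologyMap_smul
    ((HomologicalComplex.shortComplexFunctor (ModuleCat.{u} R) _ i).map f) l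

lemma homologyMap_smul_id (P : ChainComplex (ModuleCat.{u} R) ℕ) (A : ModuleCat.{u} R) (l : R)
    (i : ℕ) : HomologicalComplex.homologyMap ((tensorComplex P).map (l • 𝟙 A)) i =
      l • 𝟙 (((tensorComplex P).obj A).homology i) := by
  rw [Functor.map_smul, CategoryTheory.Functor.map_id, homologyMap_smul,
    HomologicalComplex.homologyMap_id]

/-- `Tor` computed by the chosen projective resolution of the second argument. -/
noncomputable def torIso (X Y : ModuleCat.{u} R) (P : ProjectiveResolution Y) (i : ℕ) :
    ((Tor (ModuleCat.{u} R) i).obj X).obj Y ≅ ((tensorComplex P.complex).obj X).homology i :=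
  P.isoLeftDerivedObj ((tensoringLeft (ModuleCat.{u} R)).obj X) i

lemma mono_smul_id_of_iso {X Y : ModuleCat.{u} R} (e : X ≅ Y) (l : R) (h : Mono (l • 𝟙 X)) :
    Mono (l • 𝟙 Y) := by
  have : l • 𝟙 Y = e.inv ≫ (l • 𝟙 X) ≫ e.hom := by simp
  rw [this]
  infer_instance

/-- Isomorphic modules have isomorphic cokernels of multiplication by `l`. -/
noncomputable def cokernelSmulIso {X Y : ModuleCat.{u} R} (e : X ≅ Y) (l : R) :
    cokernel (l • 𝟙 X) ≅ cokernel (l • 𝟙 Y) :=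
  cokernel.mapIso _ _ e e (by simp)

/-- Isomorphic modules have isomorphic kernels of multiplication by `l`. -/
noncomputable def kernelSmulIso {X Y : ModuleCat.{u} R} (e : X ≅ Y) (l : R) :
    kernel (l • 𝟙 X) ≅ kernel (l • 𝟙 Y) :=
  kernel.mapIso _ _ e e (by simp)

section

variable {A C : ModuleCat.{u} R} {l : R} {g : A ⟶ C} {w : (l • 𝟙 A) ≫ g = 0}

/-- If `C = A / lA` with `l` regular on `A`, and `l` is regular on the Tor module of `A` one
degree lower, then `Torᵢ(C, Y) ≅ Torᵢ(A, Y) / l`. -/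
lemma tor_iso_cokernel (hS : (ShortComplex.mk (l • 𝟙 A) g w).ShortExact) (Y : ModuleCat.{u} R)
    (i : ℕ)
    (hl : ∀ j, j + 1 = i → Mono (l • 𝟙 (((Tor (ModuleCat.{u} R) j).obj A).obj Y))) :
    Nonempty (((Tor (ModuleCat.{u} R) i).obj C).obj Y ≅
      cokernel (l • 𝟙 (((Tor (ModuleCat.{u} R) i).obj A).obj Y))) := by
  let P := projectiveResolution Y
  have hT := tensorComplex_shortExact P.complex hS
  have hex := hT.homology_exact₂ i
  have hepi : Epi (HomologicalComplex.homologyMap ((tensorComplex P.complex).map g) i) := by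
    cases i with
    | zero =>
      have hι (K : ChainComplex (ModuleCat.{u} R) ℕ) : IsIso (K.homologyι 0) :=
        K.isIso_homologyι 0 _ rfl (by simp)
      have hg : Epi ((tensorComplex P.complex).map g) := hT.epi_g
      have e := HomologicalComplex.homologyι_naturality ((tensorComplex P.complex).map g) 0
      rw [← cancel_mono (inv (HomologicalComplex.homologyι _ 0)), Category.assoc,
        IsIso.hom_inv_id, Category.comp_id, Category.assoc] at e
      rw [e]
      infer_instance
    | succ j =>
      have hδ : hT.δ (j + 1) j rfl = 0 := by
        have h := mono_smul_id_of_iso (torIso A Y P j) l (hl j rfl)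
        rw [← homologyMap_smul_id] at h
        exact Preadditive.mono_iff_cancel_zero _ |>.mp h _ _ (hT.δ_comp (j + 1) j rfl)
      exact (hT.homology_exact₃ (j + 1) j rfl).epi_f hδ
  have := (ShortComplex.exact_and_epi_g_iff_g_is_cokernel _).mp ⟨hex, hepi⟩
  let c : cokernel (l • 𝟙 (((tensorComplex P.complex).obj A).homology i)) ≅
      ((tensorComplex P.complex).obj C).homology i :=
    cokernelIsoOfEq (homologyMap_smul_id P.complex A l i).symm ≪≫
      (cokernelIsCokernel _).coconePointUniqueUpToIso this.some
  exact ⟨torIso C Y P i ≪≫ c.symm ≪≫ cokernelSmulIso (torIso A Y P i).symm l⟩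

/-- If `C = A / lA` with `l` regular on `A` and `Torᵢ₊₁(A, Y) = 0`, then `Torᵢ₊₁(C, Y)` is the
`l`-torsion in `Torᵢ(A, Y)`. -/
lemma tor_succ_iso_kernel (hS : (ShortComplex.mk (l • 𝟙 A) g w).ShortExact)
    (Y : ModuleCat.{u} R) (i : ℕ)
    (hz : IsZero (((Tor (ModuleCat.{u} R) (i + 1)).obj A).obj Y)) :
    Nonempty (((Tor (ModuleCat.{u} R) (i + 1)).obj C).obj Y ≅
      kernel (l • 𝟙 (((Tor (ModuleCat.{u} R) i).obj A).obj Y))) := by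
  let P := projectiveResolution Y
  have hT := tensorComplex_shortExact P.complex hS
  have hex := hT.homology_exact₁ (i + 1) i rfl
  have : Mono (hT.δ (i + 1) i rfl) := hT.mono_δ _ _ _ (hz.of_iso (torIso A Y P (i + 1)).symm)
  let c : kernel (l • 𝟙 (((tensorComplex P.complex).obj A).homology i)) ≅
      ((tensorComplex P.complex).obj C).homology (i + 1) :=
    kernelIsoOfEq (homologyMap_smul_id P.complex A l i).symm ≪≫
      (kernelIsKernel _).conePointUniqueUpToIso hex.fIsKernel
  exact ⟨torIso C Y P (i + 1) ≪≫ c.symm ≪≫ kernelSmulIso (torIso A Y P i).symm l⟩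

end

/-- `Tor₀(R, Y) ≅ Y`. -/
noncomputable def torZeroUnitIso (Y : ModuleCat.{u} R) :
    ((Tor (ModuleCat.{u} R) 0).obj (𝟙_ (ModuleCat.{u} R))).obj Y ≅ Y :=
  (Functor.leftDerivedZeroIsoSelf ((tensoringLeft _).obj (𝟙_ (ModuleCat.{u} R)))).app Y ≪≫ λ_ Y

lemma isZero_tor_succ_unit (Y : ModuleCat.{u} R) (i : ℕ) :
    IsZero (((Tor (ModuleCat.{u} R) (i + 1)).obj (𝟙_ (ModuleCat.{u} R))).obj Y) := by
  let P := projectiveResolution Y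
  have e : (tensorComplex P.complex).obj (𝟙_ _) ≅ P.complex :=
    HomologicalComplex.Hom.isoOfComponents (fun i ↦ λ_ (P.complex.X i))
      (fun i j _ ↦ (leftUnitor_naturality (P.complex.d i j)).symm)
  refine IsZero.of_iso ?_ (torIso _ Y P (i + 1))
  exact ((P.complex_exactAt_succ i).isZero_homology).of_iso
    ((HomologicalComplex.homologyFunctor _ _ (i + 1)).mapIso e)

section

variable {C : ModuleCat.{u} R} {x : R} {g : 𝟙_ (ModuleCat.{u} R) ⟶ C}
  {w : (x • 𝟙 (𝟙_ (ModuleCat.{u} R))) ≫ g = 0}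

lemma tor_zero_iso_cokernel (hS : (ShortComplex.mk _ g w).ShortExact) (Y : ModuleCat.{u} R) :
    Nonempty (((Tor (ModuleCat.{u} R) 0).obj C).obj Y ≅ cokernel (x • 𝟙 Y)) := by
  obtain ⟨e⟩ := tor_iso_cokernel hS Y 0 (by simp)
  exact ⟨e ≪≫ cokernelSmulIso (torZeroUnitIso Y) x⟩

lemma tor_one_iso_kernel (hS : (ShortComplex.mk _ g w).ShortExact) (Y : ModuleCat.{u} R) :
    Nonempty (((Tor (ModuleCat.{u} R) 1).obj C).obj Y ≅ kernel (x • 𝟙 Y)) := by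
  obtain ⟨e⟩ := tor_succ_iso_kernel hS Y 0 (isZero_tor_succ_unit Y 0)
  exact ⟨e ≪≫ kernelSmulIso (torZeroUnitIso Y) x⟩

lemma isZero_tor_add_two (hS : (ShortComplex.mk _ g w).ShortExact) (Y : ModuleCat.{u} R)
    (i : ℕ) : IsZero (((Tor (ModuleCat.{u} R) (i + 2)).obj C).obj Y) := by
  obtain ⟨e⟩ := tor_succ_iso_kernel hS Y (i + 1) (isZero_tor_succ_unit Y (i + 1))
  exact (IsZero.of_mono (kernel.ι _) (isZero_tor_succ_unit Y i)).of_iso e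

end

/-- The Tor modules of `C₂ = R/(x, l)` agree for two modules `Y`, `Y'` whose kernels and cokernels
of `x` are all isomorphic to one module `D` on which `l` is regular. -/
lemma tor_iso_of_kernel_cokernel {C₁ C₂ D Y Y' : ModuleCat.{u} R} {x l : R}
    {g₁ : 𝟙_ (ModuleCat.{u} R) ⟶ C₁} {w₁ : (x • 𝟙 (𝟙_ (ModuleCat.{u} R))) ≫ g₁ = 0}
    {g₂ : C₁ ⟶ C₂} {w₂ : (l • 𝟙 C₁) ≫ g₂ = 0}
    (h₁ : (ShortComplex.mk _ g₁ w₁).ShortExact) (h₂ : (ShortComplex.mk _ g₂ w₂).ShortExact)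
    (hD : Mono (l • 𝟙 D)) (k : kernel (x • 𝟙 Y) ≅ D) (c : cokernel (x • 𝟙 Y) ≅ D)
    (k' : kernel (x • 𝟙 Y') ≅ D) (c' : cokernel (x • 𝟙 Y') ≅ D) (i : ℕ) :
    Nonempty (((Tor (ModuleCat.{u} R) i).obj C₂).obj Y ≅
      ((Tor (ModuleCat.{u} R) i).obj C₂).obj Y') := by
  obtain ⟨a⟩ := tor_zero_iso_cokernel h₁ Y
  obtain ⟨a'⟩ := tor_zero_iso_cokernel h₁ Y'
  obtain ⟨b⟩ := tor_one_iso_kernel h₁ Y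
  obtain ⟨b'⟩ := tor_one_iso_kernel h₁ Y'
  have hmono {Z : ModuleCat.{u} R} (a : ((Tor (ModuleCat.{u} R) 0).obj C₁).obj Z ≅ D)
      (b : ((Tor (ModuleCat.{u} R) 1).obj C₁).obj Z ≅ D) :
      ∀ j, Mono (l • 𝟙 (((Tor (ModuleCat.{u} R) j).obj C₁).obj Z))
    | 0 => mono_smul_id_of_iso a.symm l hD
    | 1 => mono_smul_id_of_iso b.symm l hD
    | j + 2 => ⟨fun _ _ _ ↦ (isZero_tor_add_two h₁ Z j).eq_of_tgt _ _⟩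
  have hiso : ∀ j, Nonempty (((Tor (ModuleCat.{u} R) j).obj C₁).obj Y ≅
      ((Tor (ModuleCat.{u} R) j).obj C₁).obj Y')
    | 0 => ⟨a ≪≫ c ≪≫ c'.symm ≪≫ a'.symm⟩
    | 1 => ⟨b ≪≫ k ≪≫ k'.symm ≪≫ b'.symm⟩
    | j + 2 => ⟨(isZero_tor_add_two h₁ Y j).iso (isZero_tor_add_two h₁ Y' j)⟩
  obtain ⟨e⟩ := tor_iso_cokernel h₂ Y i fun j _ ↦ hmono (a ≪≫ c) (b ≪≫ k) j
  obtain ⟨e'⟩ := tor_iso_cokernel h₂ Y' i fun j _ ↦ hmono (a' ≪≫ c') (b' ≪≫ k') j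
  obtain ⟨f⟩ := hiso i
  exact ⟨e ≪≫ cokernelSmulIso f l ≪≫ e'.symm⟩

lemma shortExact_mkQ {x : R} (hx : x ∈ nonZeroDivisors R) :
    (ShortComplex.mk (x • 𝟙 (𝟙_ (ModuleCat.{u} R)))
      (ModuleCat.ofHom (Ideal.span {x}).mkQ) (by
        ext
        change Submodule.Quotient.mk (x * 1) = 0
        rw [Submodule.Quotient.mk_eq_zero, mul_one]
        exact Ideal.mem_span_singleton_self x)).ShortExact where
  exact := by
    rw [ShortComplex.ShortExact.moduleCat_exact_iff_function_exact]
    intro (a : R)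
    change Submodule.Quotient.mk a = 0 ↔ ∃ b : R, x * b = a
    rw [Submodule.Quotient.mk_eq_zero, Ideal.mem_span_singleton]
    exact ⟨fun ⟨b, h⟩ ↦ ⟨b, h.symm⟩, fun ⟨b, h⟩ ↦ ⟨b, h.symm⟩⟩
  mono_f := by
    refine (ModuleCat.mono_iff_injective _).mpr fun (a b : R) (h : x * a = x * b) ↦ ?_
    exact (mul_cancel_left_mem_nonZeroDivisors hx).mp h
  epi_g := (ModuleCat.epi_iff_surjective _).mpr (Submodule.mkQ_surjective _)

lemma smul_comp_factor {I J : Ideal R} (hIJ : I ≤ J) {l : R} (hl : l ∈ J) :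
    (l • 𝟙 (ModuleCat.of R (R ⧸ I))) ≫ ModuleCat.ofHom (Submodule.factor hIJ) = 0 := by
  ext
  change Submodule.Quotient.mk (l * 1) = 0
  rw [Submodule.Quotient.mk_eq_zero, mul_one]
  exact hl

/-- Multiplication by `l` on `R/I` has cokernel `R/(I + (l))`. -/
lemma exact_smul_factor {I J : Ideal R} {l : R} (hJ : J = I ⊔ Ideal.span {l}) (hIJ : I ≤ J)
    (hl : l ∈ J) :
    (ShortComplex.mk _ _ (smul_comp_factor hIJ hl)).Exact := by
  rw [ShortComplex.ShortExact.moduleCat_exact_iff_function_exact]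
  intro (a : R ⧸ I)
  obtain ⟨a, rfl⟩ := Submodule.Quotient.mk_surjective _ a
  change Submodule.Quotient.mk a = 0 ↔ ∃ b : R ⧸ I, l • b = Submodule.Quotient.mk a
  rw [Submodule.Quotient.mk_eq_zero, hJ]
  constructor
  · intro h
    obtain ⟨p, hp, q, hq, rfl⟩ := Submodule.mem_sup.mp h
    obtain ⟨b, rfl⟩ := Ideal.mem_span_singleton'.mp hq
    refine ⟨Submodule.Quotient.mk b, ?_⟩
    rw [← Submodule.Quotient.mk_smul, Submodule.Quotient.eq, smul_eq_mul]
    convert neg_mem hp using 1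
    ring
  · rintro ⟨b, hb⟩
    obtain ⟨b, rfl⟩ := Submodule.Quotient.mk_surjective _ b
    rw [← Submodule.Quotient.mk_smul, Submodule.Quotient.eq, smul_eq_mul] at hb
    rw [show a = -(l * b - a) + l * b by ring]
    exact add_mem (Ideal.mem_sup_left (neg_mem hb))
      (Ideal.mem_sup_right (Ideal.mul_mem_right _ _ (Ideal.mem_span_singleton_self _)))

lemma epi_factor {I J : Ideal R} (hIJ : I ≤ J) :
    Epi (ModuleCat.ofHom (Submodule.factor hIJ)) :=
  (ModuleCat.epi_iff_surjective _).mpr (Submodule.factor_surjective hIJ)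

lemma mono_smul_id_quotient {I : Ideal R} {l : R} (h : ∀ a, l * a ∈ I → a ∈ I) :
    Mono (l • 𝟙 (ModuleCat.of R (R ⧸ I))) := by
  refine (ModuleCat.mono_iff_injective _).mpr ?_
  refine (injective_iff_map_eq_zero _).mpr fun (a : R ⧸ I) ha ↦ ?_
  obtain ⟨a, rfl⟩ := Submodule.Quotient.mk_surjective _ a
  change Submodule.Quotient.mk (l * a) = 0 at ha
  rw [Submodule.Quotient.mk_eq_zero] at ha ⊢
  exact h a ha

/-- The cokernel of `x` on `R/I` is `R/(I + (x))`. -/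
noncomputable def cokernelSmulQuotientIso {I J : Ideal R} {x : R}
    (hJ : J = I ⊔ Ideal.span {x}) :
    cokernel (x • 𝟙 (ModuleCat.of R (R ⧸ I))) ≅ ModuleCat.of R (R ⧸ J) :=
  have hIJ : I ≤ J := hJ ▸ le_sup_left
  have hx : x ∈ J := hJ ▸ Ideal.mem_sup_right (Ideal.mem_span_singleton_self x)
  (cokernelIsCokernel _).coconePointUniqueUpToIso
    ((ShortComplex.exact_and_epi_g_iff_g_is_cokernel _).mp
      ⟨exact_smul_factor hJ hIJ hx, epi_factor hIJ⟩).some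

/-- If `u` induces an injection `R/J → R/I` whose image is the annihilator of `x`, the kernel of
`x` on `R/I` is `R/J`. -/
lemma kernel_smul_quotient_iso {I J : Ideal R} {x u : R} (hu : ∀ a, u * a ∈ I ↔ a ∈ J)
    (hux : u * x ∈ I) (hx : ∀ a, x * a ∈ I → a ∈ I ⊔ Ideal.span {u}) :
    Nonempty (kernel (x • 𝟙 (ModuleCat.of R (R ⧸ I))) ≅ ModuleCat.of R (R ⧸ J)) := by
  let m : (R ⧸ J) →ₗ[R] (R ⧸ I) :=
    Submodule.mapQ J I (LinearMap.lsmul R R u) fun a ha ↦ (hu a).mpr ha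
  have w : ModuleCat.ofHom m ≫ (x • 𝟙 (ModuleCat.of R (R ⧸ I))) = 0 := by
    ext
    change Submodule.Quotient.mk (x * (u * 1)) = 0
    rw [Submodule.Quotient.mk_eq_zero, mul_one, mul_comm]
    exact hux
  have hex : (ShortComplex.mk _ _ w).Exact := by
    rw [ShortComplex.ShortExact.moduleCat_exact_iff_function_exact]
    intro (a : R ⧸ I)
    obtain ⟨a, rfl⟩ := Submodule.Quotient.mk_surjective _ a
    constructor
    · intro h
      change Submodule.Quotient.mk (x * a) = 0 at h
      rw [Submodule.Quotient.mk_eq_zero] at h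
      obtain ⟨p, hp, q, hq, rfl⟩ := Submodule.mem_sup.mp (hx a h)
      obtain ⟨b, rfl⟩ := Ideal.mem_span_singleton'.mp hq
      refine ⟨(Submodule.Quotient.mk b : R ⧸ J), ?_⟩
      change (Submodule.Quotient.mk (u * b) : R ⧸ I) = _
      rw [Submodule.Quotient.eq]
      convert neg_mem hp using 1
      ring
    · rintro ⟨b, hb⟩
      rw [← hb]
      exact DFunLike.congr_fun (congrArg ModuleCat.Hom.hom w) b
  have hmono : Mono (ModuleCat.ofHom m) := by
    refine (ModuleCat.mono_iff_injective _).mpr ?_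
    refine (injective_iff_map_eq_zero _).mpr fun (a : R ⧸ J) ha ↦ ?_
    obtain ⟨a, rfl⟩ := Submodule.Quotient.mk_surjective _ a
    change (Submodule.Quotient.mk (u * a) : R ⧸ I) = 0 at ha
    rw [Submodule.Quotient.mk_eq_zero] at ha ⊢
    exact (hu a).mp ha
  exact ⟨(kernelIsKernel _).conePointUniqueUpToIso
    ((ShortComplex.exact_and_mono_f_iff_f_is_kernel _).mp ⟨hex, hmono⟩).some⟩

end Homological

/-- An endomorphism of the polynomial ring which moves every variable by an element of `J`
is the identity modulo `J`. -/
lemma sub_aeval_mem {σ A : Type*} [CommRing A] (J : Ideal (MvPolynomial σ A))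
    (s : σ → MvPolynomial σ A) (h : ∀ i, X i - s i ∈ J) (a : MvPolynomial σ A) :
    a - aeval s a ∈ J := by
  have key : (Ideal.Quotient.mkₐ A J).comp (aeval s) = Ideal.Quotient.mkₐ A J := by
    ext i
    simpa using (Ideal.Quotient.eq.mpr (h i)).symm
  exact Ideal.Quotient.eq.mp (DFunLike.congr_fun key a).symm

/-- The quadric `U₁U₂ − U₃U₄`. -/
noncomputable def quadric : R0 := U 1 * U 2 - U 3 * U 4

lemma prime_quadric : Prime quadric := by
  have h : Irreducible (-X 3 * X 4 + X 1 * X 2 : R0) := by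
    refine irreducible_mul_X_add _ _ 4 (neg_ne_zero.mpr (X_ne_zero _)) ?_ ?_ ?_
    · simp [vars_neg]
    · intro h
      have := vars_mul _ _ h
      simp at this
    · have h3 (j : Fin 7) (hj : j ≠ 3) : IsRelPrime (X 3 : R0) (X j) := by
        rw [(X_prime (i := (3 : Fin 7))).irreducible.isRelPrime_iff_not_dvd]
        simpa [X_dvd_X] using hj.symm
      rw [IsRelPrime.neg_left_iff]
      exact (h3 1 (by decide)).mul_right (h3 2 (by decide))
  have e : quadric = -X 3 * X 4 + X 1 * X 2 := by
    simp only [quadric, U]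
    ring
  rw [e]
  exact h.prime

/-- The prime ideal `(U₅ − U₀, U₆ − U₂, U₁U₂ − U₃U₄)`. -/
noncomputable def quadricIdeal : Ideal R0 := Ideal.span {U 5 - U 0, U 6 - U 2, quadric}

lemma eq_comap_aeval_quadric (J : Ideal R0) (s : Fin 7 → R0) (h : ∀ i, U i - s i ∈ J)
    (hq : quadric ∈ J) (hJ : J ≤ (Ideal.span {quadric}).comap (aeval (R := ℤ) s)) :
    J = (Ideal.span {quadric}).comap (aeval (R := ℤ) s) := by
  refine le_antisymm hJ fun a ha ↦ ?_
  have h1 : aeval s a ∈ J :=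
    (Ideal.span_le.mpr (Set.singleton_subset_iff.mpr hq)) (Ideal.mem_comap.mp ha)
  simpa using J.add_mem (sub_aeval_mem J s h a) h1

lemma isPrime_of_le_comap (J : Ideal R0) (s : Fin 7 → R0) (h : ∀ i, U i - s i ∈ J)
    (hq : quadric ∈ J) (hJ : J ≤ (Ideal.span {quadric}).comap (aeval (R := ℤ) s)) :
    J.IsPrime := by
  have := (Ideal.span_singleton_prime prime_quadric.ne_zero).mpr prime_quadric
  rw [eq_comap_aeval_quadric J s h hq hJ]
  exact Ideal.comap_isPrime _ _

instance isPrime_quadricIdeal : quadricIdeal.IsPrime := by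
  have h0 : U 5 - U 0 ∈ quadricIdeal := Ideal.subset_span (by simp)
  have h6 : U 6 - U 2 ∈ quadricIdeal := Ideal.subset_span (by simp)
  refine isPrime_of_le_comap _ ![U 5, U 1, U 2, U 3, U 4, U 5, U 2] ?_
    (Ideal.subset_span (by simp)) ?_
  · intro i
    fin_cases i <;> simp [h6]
    simpa using neg_mem h0
  · refine Ideal.span_le.mpr ?_
    rintro _ (rfl | rfl | rfl) <;> simp [U, quadric]

/-- The linear form `U₁ + U₂ − U₅ − U₆`, the sum of the two generators of `L`. -/
noncomputable def outerForm : R0 := U 1 + U 2 - U 5 - U 6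

/-- The linear form `U₁ + U₂ − U₃ − U₄`, the first generator of `L`. -/
noncomputable def innerForm : R0 := U 1 + U 2 - U 3 - U 4

lemma Qideal_eq : Qideal = quadricIdeal ⊔ Ideal.span {U 2 * outerForm} := by
  have h0 : U 5 - U 0 ∈ quadricIdeal := Ideal.subset_span (by simp)
  have h6 : U 6 - U 2 ∈ quadricIdeal := Ideal.subset_span (by simp)
  have hq : quadric ∈ quadricIdeal := Ideal.subset_span (by simp)
  have g0 : U 5 - U 0 ∈ Qideal := Ideal.subset_span (by simp)
  have g6 : U 6 - U 2 ∈ Qideal := Ideal.subset_span (by simp)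
  have gq : quadric ∈ Qideal := Ideal.subset_span (by simp [quadric])
  have gr : U 3 * U 4 - U 5 * U 6 ∈ Qideal := Ideal.subset_span (by simp)
  apply le_antisymm
  · refine Ideal.span_le.mpr ?_
    rintro _ (rfl | rfl | rfl | rfl)
    · exact Ideal.mem_sup_left h0
    · exact Ideal.mem_sup_left h6
    · exact Ideal.mem_sup_left hq
    · have e : U 3 * U 4 - U 5 * U 6 =
          (U 2 - U 5) * (U 6 - U 2) - quadric + U 2 * outerForm := by
        simp only [quadric, outerForm]; ring
      rw [e]
      exact add_mem (Ideal.mem_sup_left (sub_mem (Ideal.mul_mem_left _ _ h6) hq))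
        (Ideal.mem_sup_right (Ideal.mem_span_singleton_self _))
  · refine sup_le (Ideal.span_le.mpr ?_) ?_
    · rintro _ (rfl | rfl | rfl)
      exacts [g0, g6, gq]
    · rw [Ideal.span_singleton_le_iff_mem]
      have e : U 2 * outerForm =
          (U 3 * U 4 - U 5 * U 6) - ((U 2 - U 5) * (U 6 - U 2) - quadric) := by
        simp only [quadric, outerForm]; ring
      rw [e]
      exact sub_mem gr (sub_mem (Ideal.mul_mem_left _ _ g6) gq)

lemma Nideal_eq : Nideal = quadricIdeal ⊔ Ideal.span {outerForm} := by
  have h6 : U 6 - U 2 ∈ quadricIdeal := Ideal.subset_span (by simp)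
  rw [Nideal, Qideal_eq, Submodule.add_eq_sup]
  apply le_antisymm
  · refine sup_le (sup_le le_sup_left ?_) ?_
    · rw [Ideal.span_singleton_le_iff_mem]
      exact Ideal.mem_sup_right (Ideal.mul_mem_left _ _ (Ideal.mem_span_singleton_self _))
    · rw [Ideal.span_singleton_le_iff_mem,
        show U 1 - U 5 = (U 6 - U 2) + outerForm by simp only [outerForm]; ring]
      exact add_mem (Ideal.mem_sup_left h6)
        (Ideal.mem_sup_right (Ideal.mem_span_singleton_self _))
  · refine sup_le (le_sup_left.trans le_sup_left) ?_
    rw [Ideal.span_singleton_le_iff_mem,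
      show outerForm = -(U 6 - U 2) + (U 1 - U 5) by simp only [outerForm]; ring]
    exact add_mem (Ideal.mem_sup_left (Ideal.mem_sup_left (neg_mem h6)))
      (Ideal.mem_sup_right (Ideal.mem_span_singleton_self _))

lemma Nideal_eq_sup : Nideal = Qideal ⊔ Ideal.span {outerForm} := by
  rw [Nideal_eq, Qideal_eq, sup_assoc]
  congr 1
  rw [eq_comm, sup_eq_right, Ideal.span_singleton_le_iff_mem]
  exact Ideal.mul_mem_left _ _ (Ideal.mem_span_singleton_self _)

instance isPrime_Nideal : Nideal.IsPrime := by
  have h0 : U 5 - U 0 ∈ Nideal :=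
    Nideal_eq ▸ Ideal.mem_sup_left (Ideal.subset_span (by simp))
  have h6 : U 6 - U 2 ∈ Nideal :=
    Nideal_eq ▸ Ideal.mem_sup_left (Ideal.subset_span (by simp))
  have hq : quadric ∈ Nideal :=
    Nideal_eq ▸ Ideal.mem_sup_left (Ideal.subset_span (by simp))
  have h1 : U 1 - U 5 ∈ Nideal := Ideal.mem_sup_right (Ideal.mem_span_singleton_self _)
  have h5 : U 5 - U 1 ∈ Nideal := by simpa using neg_mem h1
  have h01 : U 0 - U 1 ∈ Nideal := by simpa using sub_mem h5 h0
  refine isPrime_of_le_comap _ ![U 1, U 1, U 2, U 3, U 4, U 1, U 2] ?_ hq ?_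
  · intro i
    fin_cases i <;> simp [h6, h01, h5]
  · rw [Nideal_eq]
    refine sup_le (Ideal.span_le.mpr ?_) (Ideal.span_le.mpr ?_)
    · rintro _ (rfl | rfl | rfl) <;> simp [U, quadric]
    · rintro _ rfl
      simp [U, outerForm]

/-- A polynomial that does not vanish at an integer point of the quadric cone is not in
`quadricIdeal`. -/
lemma notMem_quadricIdeal {a : R0} (v : Fin 7 → ℤ) (h5 : v 5 = v 0) (h6 : v 6 = v 2)
    (hq : v 1 * v 2 = v 3 * v 4) (ha : aeval v a ≠ 0) : a ∉ quadricIdeal := by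
  intro h
  have hle : quadricIdeal ≤ RingHom.ker (aeval (R := ℤ) v) := by
    refine Ideal.span_le.mpr ?_
    rintro _ (rfl | rfl | rfl) <;> simp [U, quadric, RingHom.mem_ker, *]
  exact ha (hle h)

lemma outerForm_notMem : outerForm ∉ quadricIdeal :=
  notMem_quadricIdeal ![0, 1, 0, 0, 0, 0, 0] (by simp) (by simp) (by simp) (by simp [outerForm, U])

lemma U_two_notMem : U 2 ∉ quadricIdeal :=
  notMem_quadricIdeal ![0, 0, 1, 0, 0, 0, 1] (by simp) (by simp) (by simp) (by simp [U])

lemma innerForm_notMem : innerForm ∉ Nideal := by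
  intro h
  have hle : Nideal ≤ RingHom.ker (aeval (R := ℤ) (![1, 1, 0, 0, 0, 1, 0] : Fin 7 → ℤ)) := by
    rw [Nideal_eq]
    refine sup_le (Ideal.span_le.mpr ?_) (Ideal.span_le.mpr ?_)
    · rintro _ (rfl | rfl | rfl) <;> simp [U, quadric, RingHom.mem_ker]
    · rintro _ rfl
      simp [U, outerForm, RingHom.mem_ker]
  have := hle h
  simp [innerForm, U, RingHom.mem_ker] at this

lemma mem_sup_of_mul_mem {A : Type*} [CommRing A] {P : Ideal A} [P.IsPrime] {u x a : A}
    (hu : u ∉ P) (h : u * a ∈ P ⊔ Ideal.span {u * x}) : a ∈ P ⊔ Ideal.span {x} := by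
  obtain ⟨p, hp, q, hq, e⟩ := Submodule.mem_sup.mp h
  obtain ⟨b, rfl⟩ := Ideal.mem_span_singleton'.mp hq
  have h1 : u * (a - b * x) ∈ P := by
    rw [show u * (a - b * x) = p by linear_combination -e]
    exact hp
  have h2 := (Ideal.IsPrime.mem_or_mem ‹_› h1).resolve_left hu
  rw [show a = (a - b * x) + b * x by ring]
  exact add_mem (Ideal.mem_sup_left h2)
    (Ideal.mem_sup_right (Ideal.mul_mem_left _ _ (Ideal.mem_span_singleton_self _)))

lemma U_two_mul_mem_Qideal_iff (a : R0) : U 2 * a ∈ Qideal ↔ a ∈ Nideal := by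
  constructor
  · rw [Qideal_eq, Nideal_eq]
    exact mem_sup_of_mul_mem U_two_notMem
  · rw [Nideal_eq, Qideal_eq]
    intro h
    obtain ⟨p, hp, q, hq, rfl⟩ := Submodule.mem_sup.mp h
    obtain ⟨b, rfl⟩ := Ideal.mem_span_singleton'.mp hq
    rw [mul_add, mul_left_comm]
    exact add_mem (Ideal.mem_sup_left (Ideal.mul_mem_left _ _ hp))
      (Ideal.mem_sup_right (Ideal.mul_mem_left _ _ (Ideal.mem_span_singleton_self _)))

lemma mem_of_outerForm_mul_mem_Qideal {a : R0} (h : outerForm * a ∈ Qideal) :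
    a ∈ Qideal ⊔ Ideal.span {U 2} := by
  rw [Qideal_eq, mul_comm (U 2)] at h
  have hle : quadricIdeal ≤ Qideal := Qideal_eq ▸ le_sup_left
  exact sup_le_sup_right hle (Ideal.span {U 2}) (mem_sup_of_mul_mem outerForm_notMem h)

lemma outerForm_ne_zero : outerForm ≠ 0 := fun h ↦
  outerForm_notMem (h ▸ zero_mem _)

lemma Lideal_eq : Lideal = Ideal.span {outerForm} ⊔ Ideal.span {innerForm} := by
  rw [← Ideal.span_insert]
  apply le_antisymm <;> refine Ideal.span_le.mpr ?_
  · rintro _ (rfl | rfl)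
    · exact Ideal.subset_span (by simp [innerForm])
    · rw [show U 3 + U 4 - U 5 - U 6 = outerForm - innerForm by
        simp only [outerForm, innerForm]; ring]
      exact sub_mem (Ideal.subset_span (by simp)) (Ideal.subset_span (by simp))
  · rintro _ (rfl | rfl)
    · rw [show outerForm = (U 1 + U 2 - U 3 - U 4) + (U 3 + U 4 - U 5 - U 6) by
        simp only [outerForm]; ring]
      exact add_mem (Ideal.subset_span (by simp)) (Ideal.subset_span (by simp))
    · exact Ideal.subset_span (by simp [innerForm])

lemma mem_of_innerForm_mul_mem {a : R0} (h : innerForm * a ∈ Ideal.span {outerForm}) :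
    a ∈ Ideal.span {outerForm} := by
  let s : Fin 7 → R0 := ![U 0, U 1, U 2, U 3, U 4, U 1 + U 2 - U 6, U 6]
  have hs : aeval s outerForm = 0 := by simp [s, outerForm, U]
  have hi : aeval s innerForm = innerForm := by simp [s, innerForm, U]
  obtain ⟨b, hb⟩ := Ideal.mem_span_singleton'.mp h
  have h0 : innerForm * aeval s a = 0 := by
    rw [← hi, ← map_mul, ← hb, map_mul, hs, mul_zero]
  have hne : innerForm ≠ 0 := fun h ↦ innerForm_notMem (h ▸ zero_mem _)
  have ha := (mul_eq_zero.mp h0).resolve_left hne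
  have := sub_aeval_mem (Ideal.span {outerForm}) s (fun i ↦ ?_) a
  · rwa [ha, sub_zero] at this
  · have h5 : U 5 - (U 1 + U 2 - U 6) ∈ Ideal.span {outerForm} := by
      rw [show U 5 - (U 1 + U 2 - U 6) = -outerForm by simp only [outerForm]; ring]
      exact neg_mem (Ideal.mem_span_singleton_self _)
    fin_cases i <;> simp [s, U]
    exact h5

lemma outerForm_mem_Nideal : outerForm ∈ Nideal :=
  Nideal_eq_sup ▸ Ideal.mem_sup_right (Ideal.mem_span_singleton_self _)

end KoszulTor

open KoszulTor in
/-- For every `i`, there is an isomorphism of `R`-modules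
`Tor_i^R(R/L, R/N) ≅ Tor_i^R(R/L, R/Q)`. -/
theorem tor_iso (i : ℕ) :
    Nonempty
      ((((Tor (ModuleCat R0) i).obj (ModuleCat.of R0 (R0 ⧸ Lideal))).obj
          (ModuleCat.of R0 (R0 ⧸ Nideal))) ≅
        (((Tor (ModuleCat R0) i).obj (ModuleCat.of R0 (R0 ⧸ Lideal))).obj
          (ModuleCat.of R0 (R0 ⧸ Qideal)))) := by
  have hle : Ideal.span {outerForm} ≤ Lideal := Lideal_eq ▸ le_sup_left
  have hmem : innerForm ∈ Lideal :=
    Lideal_eq ▸ Ideal.mem_sup_right (Ideal.mem_span_singleton_self _)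
  have h₂ : (ShortComplex.mk _ _ (smul_comp_factor hle hmem)).ShortExact :=
    { exact := exact_smul_factor Lideal_eq hle hmem
      mono_f := mono_smul_id_quotient fun _ ↦ mem_of_innerForm_mul_mem
      epi_g := epi_factor hle }
  obtain ⟨k⟩ := kernel_smul_quotient_iso (I := Nideal) (J := Nideal) (x := outerForm) (u := 1)
    (by simp) (by simpa using outerForm_mem_Nideal) (by simp)
  obtain ⟨k'⟩ := kernel_smul_quotient_iso (x := outerForm) U_two_mul_mem_Qideal_iff
    ((U_two_mul_mem_Qideal_iff _).mpr outerForm_mem_Nideal)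
    fun _ ↦ mem_of_outerForm_mul_mem_Qideal
  exact tor_iso_of_kernel_cokernel
    (shortExact_mkQ (mem_nonZeroDivisors_of_ne_zero outerForm_ne_zero)) h₂
    (mono_smul_id_quotient fun _ h ↦
      (isPrime_Nideal.mem_or_mem h).resolve_left innerForm_notMem)
    k (cokernelSmulQuotientIso (by simpa using outerForm_mem_Nideal))
    k' (cokernelSmulQuotientIso Nideal_eq_sup) i
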